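/- arXiv:2210.14719 — 3 statements merged into one kernel-verified Lean document; each statement's English description precedes it below -/
import Mathlib

section
/- Let f be a folding instruction set and n ≥ 7 an integer with 2^(k-1) < n ≤ 2^k. Then A_f(n) = 4·2^k + n − 1 if f_{k+1} ≠ f_{k+2}, and A_f(n) = 6·2^k + n − 1 if f_{k+1} = f_{k+2}. -/
/-- A folding instruction set: a sequence with values in {-1, 1}. -/
def FoldingSeq (f : ℕ → ℤ) : Prop := ∀ s, f s = 1 ∨ f s = -1

/-- The paper-folding sequence `P_f`: if `k = 2^s * r` with `r` odd, then
`P_f[k] = f s` if `r ≡ 1 [MOD 4]` and `P_f[k] = -f s` if `r ≡ 3 [MOD 4]`. -/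
def PF (f : ℕ → ℤ) (k : ℕ) : ℤ :=
  if (k / 2 ^ (padicValNat 2 k)) % 4 = 1 then f (padicValNat 2 k)
  else -f (padicValNat 2 k)

/-- The length-`n` factors of `P_f` starting at indices `i` and `j` are identical. -/
def FactorMatch (f : ℕ → ℤ) (n i j : ℕ) : Prop :=
  ∀ t, t < n → PF f (i + t) = PF f (j + t)

/-- `Sf f n` : the least positive integer `m` such that every length-`n` factor of `P_f`
starts somewhere within the first `m` positions. -/
noncomputable def Sf (f : ℕ → ℤ) (n : ℕ) : ℕ :=
  sInf {m | 1 ≤ m ∧ ∀ i, 1 ≤ i → ∃ j, 1 ≤ j ∧ j ≤ m ∧ FactorMatch f n i j}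

/-- `Af f n` : the least positive integer `m` such that every length-`n` factor of `P_f`
appears entirely within the prefix `P_f[1..m]`. -/
noncomputable def Af (f : ℕ → ℤ) (n : ℕ) : ℕ :=
  sInf {m | 1 ≤ m ∧ ∀ i, 1 ≤ i → ∃ j, 1 ≤ j ∧ j + n - 1 ≤ m ∧ FactorMatch f n i j}

/-- `phi2 n` : the least power of 2 that is `≥ n`, i.e. `2 ^ ⌈log₂ n⌉`. -/
def phi2 (n : ℕ) : ℕ := 2 ^ Nat.clog 2 n

theorem padicValNat_two_pow_mul_odd (s r : ℕ) (hr : r % 2 = 1) :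
    padicValNat 2 (2 ^ s * r) = s := by
  rw [padicValNat.mul (by positivity) (by omega), padicValNat.prime_pow,
    padicValNat.eq_zero_of_not_dvd (by omega), add_zero]

theorem PF_two_pow_mul_odd (f : ℕ → ℤ) (s r : ℕ) (hr : r % 2 = 1) :
    PF f (2 ^ s * r) = if r % 4 = 1 then f s else -f s := by
  simp only [PF, padicValNat_two_pow_mul_odd s r hr]
  rw [Nat.mul_div_cancel_left _ (by positivity)]

theorem FoldingSeq.neg_ne {f : ℕ → ℤ} (hf : FoldingSeq f) (s : ℕ) : -f s ≠ f s := by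
  rcases hf s with h | h <;> rw [h] <;> decide

theorem FoldingSeq.PF_eq_or {f : ℕ → ℤ} (hf : FoldingSeq f) (x : ℕ) :
    PF f x = 1 ∨ PF f x = -1 := by
  unfold PF
  rcases hf (padicValNat 2 x) with h | h <;> rw [h] <;> split_ifs <;> simp

theorem PF_two_pow_mul_add (f : ℕ → ℤ) {k x : ℕ} (hx : ¬ 2 ^ k ∣ x) (c : ℕ) :
    PF f (2 ^ (k + 1) * c + x) = PF f x := by
  have hx0 : x ≠ 0 := by rintro rfl; simp at hx
  obtain ⟨s, r, hr, rfl⟩ := Nat.exists_eq_two_pow_mul_odd hx0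
  have hs : s < k := by
    by_contra! h
    exact hx ((pow_dvd_pow 2 h).mul_right r)
  obtain ⟨d, rfl⟩ := Nat.exists_eq_add_of_lt hs
  have hr' : r % 2 = 1 := Nat.odd_iff.mp hr
  have he : 2 ^ (s + d + 1 + 1) * c + 2 ^ s * r = 2 ^ s * (4 * (2 ^ d * c) + r) := by ring
  rw [he, PF_two_pow_mul_odd f s _ (by omega), PF_two_pow_mul_odd f s r hr', Nat.mul_add_mod]

/-- A factor of length at least 7 starting at a multiple of `2 ^ (k + 1)` occurs
only at even positions. -/
theorem FactorMatch.even_of_two_pow_dvd {f : ℕ → ℤ} (hf : FoldingSeq f) {n k i j : ℕ}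
    (hn : 7 ≤ n) (hk : 3 ≤ k) (hi : 2 ^ (k + 1) ∣ i) (h : FactorMatch f n i j) : 2 ∣ j := by
  by_contra hj
  obtain ⟨c, rfl⟩ : 16 ∣ i := (pow_dvd_pow 2 (by omega : 4 ≤ k + 1)).trans hi
  have h2 := h 2 (by omega)
  have h6 := h 6 (by omega)
  rw [show 16 * c + 2 = 2 ^ 1 * (8 * c + 1) by ring,
    PF_two_pow_mul_odd f 1 _ (by omega), if_pos (by omega)] at h2
  rw [show 16 * c + 6 = 2 ^ 1 * (8 * c + 3) by ring,
    PF_two_pow_mul_odd f 1 _ (by omega), if_neg (by omega)] at h6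
  have hper := PF_two_pow_mul_add f (k := 1) (x := j + 2) (by omega) 1
  rw [show 2 ^ (1 + 1) * 1 + (j + 2) = j + 6 by ring] at hper
  exact hf.neg_ne 1 (by rw [h6, hper, ← h2])

theorem FactorMatch.two_pow_dvd {f : ℕ → ℤ} (hf : FoldingSeq f) {n k i j : ℕ}
    (hn : 7 ≤ n) (hk : 3 ≤ k) (hkn : 2 ^ (k - 1) < n) (hi : 2 ^ (k + 1) ∣ i)
    (h : FactorMatch f n i j) : 2 ^ (k + 1) ∣ j := by
  suffices ∀ s ≤ k, 2 ^ (s + 1) ∣ j from this k le_rfl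
  intro s
  induction s with
  | zero => intro _; simpa using h.even_of_two_pow_dvd hf hn hk hi
  | succ s ih =>
    intro hs
    obtain ⟨q, rfl⟩ := ih (by omega)
    obtain ⟨c, rfl⟩ := (pow_dvd_pow 2 (by omega : s + 2 ≤ k + 1)).trans hi
    have ht := h (2 ^ s) ((Nat.pow_le_pow_right (by norm_num) (by omega)).trans_lt hkn)
    rw [show 2 ^ (s + 2) * c + 2 ^ s = 2 ^ s * (4 * c + 1) by ring,
      show 2 ^ (s + 1) * q + 2 ^ s = 2 ^ s * (2 * q + 1) by ring,
      PF_two_pow_mul_odd f s _ (by omega), PF_two_pow_mul_odd f s _ (by omega),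
      if_pos (by omega)] at ht
    split_ifs at ht with hq
    · rw [pow_succ 2 (s + 1)]
      exact mul_dvd_mul_left _ (by omega)
    · exact absurd ht.symm (hf.neg_ne s)

/-- If the multiples `2 ^ (k + 1)` and `2 ^ (k + 1) * (d + 1)` carry different values, every
factor of length at most `2 ^ k` starts within the first `2 ^ (k + 1) * (d + 1)` positions. -/
theorem exists_factorMatch_le {f : ℕ → ℤ} (hf : FoldingSeq f) {n k d : ℕ} (hd : 1 ≤ d)
    (hn : n ≤ 2 ^ k) (hne : PF f (2 ^ (k + 1)) ≠ PF f (2 ^ (k + 1) * (d + 1))) {i : ℕ}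
    (hi : 1 ≤ i) : ∃ j, 1 ≤ j ∧ j ≤ 2 ^ (k + 1) * (d + 1) ∧ FactorMatch f n i j := by
  have hN : 0 < 2 ^ k := by positivity
  have hp : 2 ^ (k + 1) = 2 * 2 ^ k := pow_succ' 2 k
  obtain ⟨q, b, hb1, hb2, rfl⟩ :
      ∃ q b, 1 ≤ b ∧ b ≤ 2 ^ (k + 1) ∧ i = 2 ^ (k + 1) * q + b := by
    refine ⟨(i - 1) / 2 ^ (k + 1), (i - 1) % 2 ^ (k + 1) + 1, by omega,
      Nat.mod_lt _ (by positivity), ?_⟩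
    have := Nat.div_add_mod (i - 1) (2 ^ (k + 1))
    omega
  rcases le_or_gt b (2 ^ k) with hb | hb
  · refine ⟨2 ^ (k + 1) * (q % 2) + b, by omega, ?_, fun t ht => ?_⟩
    · have h1 : 2 ^ (k + 1) * (q % 2) ≤ 2 ^ (k + 1) * d := Nat.mul_le_mul_left _ (by omega)
      rw [mul_add]
      omega
    · have hx : ¬ 2 ^ (k + 1) ∣ 2 ^ (k + 1) * (q % 2) + (b + t) := by
        rw [Nat.dvd_add_right (dvd_mul_right _ _)]
        exact Nat.not_dvd_of_pos_of_lt (by omega) (by omega)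
      have := PF_two_pow_mul_add f hx (q / 2)
      rw [add_assoc, add_assoc, ← this]
      congr 1
      conv_lhs => rw [← Nat.div_add_mod q 2]
      ring
  · obtain ⟨e, he, hv⟩ : ∃ e ≤ d, PF f (2 ^ (k + 1) * (q + 1)) = PF f (2 ^ (k + 1) * (e + 1)) := by
      by_cases h0 : PF f (2 ^ (k + 1) * (q + 1)) = PF f (2 ^ (k + 1))
      · exact ⟨0, by omega, by simpa using h0⟩
      · refine ⟨d, le_rfl, ?_⟩
        rcases hf.PF_eq_or (2 ^ (k + 1) * (q + 1)) with h1 | h1 <;>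
        rcases hf.PF_eq_or (2 ^ (k + 1)) with h2 | h2 <;>
        rcases hf.PF_eq_or (2 ^ (k + 1) * (d + 1)) with h3 | h3 <;> simp_all
    refine ⟨2 ^ (k + 1) * e + b, by omega, ?_, fun t ht => ?_⟩
    · have h1 : 2 ^ (k + 1) * e ≤ 2 ^ (k + 1) * d := Nat.mul_le_mul_left _ he
      rw [mul_add]
      omega
    · rw [add_assoc, add_assoc]
      by_cases hbt : b + t = 2 ^ (k + 1)
      · rw [hbt]
        exact hv
      · have hx : ¬ 2 ^ k ∣ b + t := by
          rintro ⟨c, hc⟩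
          have h1 : 1 < c := by
            by_contra! h
            have := Nat.mul_le_mul_left (2 ^ k) h
            omega
          have h3 : c < 3 := by
            by_contra! h
            have := Nat.mul_le_mul_left (2 ^ k) h
            omega
          obtain rfl : c = 2 := by omega
          omega
        rw [PF_two_pow_mul_add f hx, PF_two_pow_mul_add f hx]

theorem Af_eq_of_first_occurrence {f : ℕ → ℤ} {n M : ℕ} (hM : 1 ≤ M)
    (hle : ∀ i, 1 ≤ i → ∃ j, 1 ≤ j ∧ j ≤ M ∧ FactorMatch f n i j)
    (hge : ∀ j, 1 ≤ j → FactorMatch f n M j → M ≤ j) (hn : 1 ≤ n) : Af f n = M + n - 1 := by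
  refine IsLeast.csInf_eq ⟨⟨by omega, fun i hi => ?_⟩, fun m hm => ?_⟩
  · obtain ⟨j, hj, hjM, h⟩ := hle i hi
    exact ⟨j, hj, by omega, h⟩
  · obtain ⟨j, hj, hjm, h⟩ := hm.2 M hM
    have := hge j hj h
    omega

/-- If `2 ^ (k + 1) * (d + 1)` is the first multiple of `2 ^ (k + 1)` whose value differs from
that at `2 ^ (k + 1)`, then the last factor of length `n` to appear starts there. -/
theorem Af_eq_of_first_change {f : ℕ → ℤ} (hf : FoldingSeq f) {n k d : ℕ} (hn : 7 ≤ n)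
    (hk : 3 ≤ k) (hk1 : 2 ^ (k - 1) < n) (hk2 : n ≤ 2 ^ k) (hd : 1 ≤ d)
    (hne : ∀ e < d, PF f (2 ^ (k + 1) * (e + 1)) ≠ PF f (2 ^ (k + 1) * (d + 1))) :
    Af f n = 2 ^ (k + 1) * (d + 1) + n - 1 := by
  refine Af_eq_of_first_occurrence (Nat.mul_pos (by positivity) (by omega))
    (fun i hi => exists_factorMatch_le hf hd hk2 (by simpa using hne 0 hd) hi)
    (fun j hj h => ?_) (by omega)
  obtain ⟨c, rfl⟩ := h.two_pow_dvd hf hn hk hk1 (dvd_mul_right _ _)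
  refine Nat.mul_le_mul_left _ ?_
  by_contra! hc
  have hc0 : c ≠ 0 := by rintro rfl; simp at hj
  obtain ⟨e, rfl⟩ := Nat.exists_eq_succ_of_ne_zero hc0
  exact hne e (by omega) (by simpa using (h 0 (by omega)).symm)

theorem stmt1 (f : ℕ → ℤ) (hf : FoldingSeq f) (n k : ℕ) (hn : 7 ≤ n)
    (hk1 : 2 ^ (k - 1) < n) (hk2 : n ≤ 2 ^ k) :
    (f (k + 1) ≠ f (k + 2) → Af f n = 4 * 2 ^ k + n - 1) ∧
    (f (k + 1) = f (k + 2) → Af f n = 6 * 2 ^ k + n - 1) := by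
  have hk : 3 ≤ k := by
    by_contra! h
    have := Nat.pow_le_pow_right (n := 2) (by norm_num) (by omega : k ≤ 2)
    omega
  have h1 : PF f (2 ^ (k + 1) * (0 + 1)) = f (k + 1) := PF_two_pow_mul_odd f (k + 1) 1 rfl
  have h2 : PF f (2 ^ (k + 1) * (1 + 1)) = f (k + 2) := by
    rw [show 2 ^ (k + 1) * (1 + 1) = 2 ^ (k + 2) * 1 by ring]
    exact PF_two_pow_mul_odd f (k + 2) 1 rfl
  have h3 : PF f (2 ^ (k + 1) * (2 + 1)) = -f (k + 1) := PF_two_pow_mul_odd f (k + 1) 3 rfl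
  constructor
  · intro hne
    rw [Af_eq_of_first_change hf hn hk hk1 hk2 (d := 1) le_rfl]
    · ring_nf
    · intro e he
      obtain rfl : e = 0 := by omega
      rwa [h1, h2]
  · intro heq
    rw [Af_eq_of_first_change hf hn hk hk1 hk2 (d := 2) (by norm_num)]
    · ring_nf
    · intro e he
      rw [h3]
      interval_cases e
      · rw [h1]
        exact (hf.neg_ne _).symm
      · rw [h2, ← heq]
        exact (hf.neg_ne _).symm
end

section
/- Let f be a folding instruction set and n ≥ 7. If k is an index with 1 ≤ k < 6·φ(n), k ≠ 4·φ(n), then the length-n factors of P_f starting at indices k and 6·φ(n) are not identical; i.e., the length-n factor P_f[6·φ(n) : 6·φ(n)+n−1] first appears in P_f starting at either index 4·φ(n) or index 6·φ(n), and it appears nowhere else in the prefix P_f[1 : 6·φ(n)+n−1]. -/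
theorem PF_two_pow_mul (f : ℕ → ℤ) (s : ℕ) {r : ℕ} (hr : r % 2 = 1) :
    PF f (2 ^ s * r) = if r % 4 = 1 then f s else -f s := by
  have hv : padicValNat 2 (2 ^ s * r) = s := by
    rw [padicValNat.mul (by positivity) (by omega), padicValNat.prime_pow,
      padicValNat.eq_zero_of_not_dvd (by omega), add_zero]
  unfold PF
  rw [hv, Nat.mul_div_cancel_left _ (by positivity)]

theorem FoldingSeq.ne_neg_self {f : ℕ → ℤ} (hf : FoldingSeq f) (s : ℕ) : f s ≠ -f s := by
  rcases hf s with h | h <;> rw [h] <;> decide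

theorem FoldingSeq.PF_two_pow_mul_eq_iff {f : ℕ → ℤ} (hf : FoldingSeq f) (s : ℕ) {r q : ℕ}
    (hr : r % 2 = 1) (hq : q % 2 = 1) :
    PF f (2 ^ s * r) = PF f (2 ^ s * q) ↔ r % 4 = q % 4 := by
  have h := hf.ne_neg_self s
  rw [PF_two_pow_mul f s hr, PF_two_pow_mul f s hq]
  split_ifs <;> grind

/-- A factor of length at least `7` starting at a multiple of `4` cannot start at an odd index. -/
theorem FactorMatch.even_left {f : ℕ → ℤ} (hf : FoldingSeq f) {n k j : ℕ} (hn : 7 ≤ n)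
    (h : FactorMatch f n k j) (hj : 4 ∣ j) : 2 ∣ k := by
  by_contra hk
  obtain ⟨c, rfl⟩ := hj
  have hk26 : PF f (k + 2) = PF f (k + 6) := by
    simpa using (hf.PF_two_pow_mul_eq_iff 0 (r := k + 2) (q := k + 6) (by omega)
      (by omega)).2 (by omega)
  have hj26 : PF f (2 ^ 1 * (2 * c + 1)) = PF f (2 ^ 1 * (2 * c + 3)) := by
    convert (h 2 (by omega)).symm.trans (hk26.trans (h 6 (by omega))) using 2 <;> ring
  have := (hf.PF_two_pow_mul_eq_iff 1 (by omega) (by omega)).1 hj26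
  omega

/-- If an even index starts the same factor as a multiple of `2 ^ (s + 2)`, and the factor is long
enough to reach offset `2 ^ s`, then that index is itself divisible by `2 ^ (s + 2)`. -/
theorem FactorMatch.two_pow_dvd_left {f : ℕ → ℤ} (hf : FoldingSeq f) {n k j : ℕ}
    (h : FactorMatch f n k j) (hk : 2 ∣ k) (s : ℕ) (hs : 2 ^ s < n) (hj : 2 ^ (s + 2) ∣ j) :
    2 ^ (s + 2) ∣ k := by
  have hk' : 2 ^ (s + 1) ∣ k := by
    cases s with
    | zero => simpa using hk
    | succ s =>
      exact h.two_pow_dvd_left hf hk s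
        ((Nat.pow_lt_pow_right one_lt_two s.lt_succ_self).trans hs)
        ((pow_dvd_pow 2 (by omega)).trans hj)
  obtain ⟨c, rfl⟩ := hk'
  obtain ⟨d, rfl⟩ := hj
  have hcd : PF f (2 ^ s * (2 * c + 1)) = PF f (2 ^ s * (4 * d + 1)) := by
    convert h (2 ^ s) hs using 2 <;> ring
  have := (hf.PF_two_pow_mul_eq_iff s (by omega) (by omega)).1 hcd
  obtain ⟨e, rfl⟩ : 2 ∣ c := by omega
  exact ⟨e, by ring⟩

theorem stmt4 (f : ℕ → ℤ) (hf : FoldingSeq f) (n : ℕ) (hn : 7 ≤ n)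
    (k : ℕ) (hk1 : 1 ≤ k) (hk2 : k < 6 * phi2 n) (hk3 : k ≠ 4 * phi2 n) :
    ¬ FactorMatch f n k (6 * phi2 n) := by
  intro h
  obtain ⟨m, hm⟩ : ∃ m, Nat.clog 2 n = m + 1 :=
    Nat.exists_eq_succ_of_ne_zero (Nat.clog_pos one_lt_two (by omega)).ne'
  have hmn : 2 ^ m < n := (Nat.lt_clog_iff_pow_lt one_lt_two).1 (by omega)
  have hphi : phi2 n = 2 ^ (m + 1) := by rw [phi2, hm]
  have hj : 6 * phi2 n = 2 ^ (m + 2) * 3 := by rw [hphi]; ring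
  have hj4 : 4 * phi2 n = 2 ^ (m + 2) * 2 := by rw [hphi]; ring
  rw [hj] at h hk2
  rw [hj4] at hk3
  have h4 : 4 ∣ 2 ^ (m + 2) * 3 := ⟨2 ^ m * 3, by ring⟩
  obtain ⟨c, rfl⟩ := h.two_pow_dvd_left hf (h.even_left hf hn h4) m hmn (Dvd.intro _ rfl)
  have hc3 : c < 3 := lt_of_mul_lt_mul_left' hk2
  have hc2 : c ≠ 2 := fun hc => hk3 (by rw [hc])
  have hc0 : c ≠ 0 := by rintro rfl; simp at hk1
  obtain rfl : c = 1 := by omega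
  have := (hf.PF_two_pow_mul_eq_iff (m + 2) (by norm_num) (by norm_num)).1 (h 0 (by omega))
  omega
end

section
/- For every folding instruction set f, S_f(3) ∈ {14, 16, 22, 24}, and consequently A_f(3) ∈ {16, 18, 24, 26}. -/
/-- The value at `k` of the paper-folding sequence whose first folding instructions are listed
in `l`; it is meaningful when `2 ^ l.length` does not divide `k`. -/
def foldList : List ℤ → ℕ → ℤ
  | [], _ => 0
  | a :: l, k => if k % 4 = 1 then a else if k % 4 = 3 then -a else foldList l (k / 2)

theorem PF_two_mul (f : ℕ → ℤ) {k : ℕ} (hk : k ≠ 0) :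
    PF f (2 * k) = PF (fun s => f (s + 1)) k := by
  have h : padicValNat 2 (2 * k) = padicValNat 2 k + 1 := by
    rw [padicValNat.mul two_ne_zero hk, padicValNat_self, add_comm]
  simp only [PF, h]
  rw [pow_succ', Nat.mul_div_mul_left _ _ two_pos]

theorem PF_of_odd (f : ℕ → ℤ) {k : ℕ} (hk : k % 2 = 1) :
    PF f k = if k % 4 = 1 then f 0 else -f 0 := by
  have h : padicValNat 2 k = 0 := padicValNat.eq_zero_of_not_dvd (by omega)
  simp [PF, h]

theorem PF_eq_foldList (n : ℕ) (f : ℕ → ℤ) {k : ℕ} (hk : ¬ 2 ^ n ∣ k) :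
    PF f k = foldList (List.ofFn fun s : Fin n => f s) k := by
  induction n generalizing f k with
  | zero => simp at hk
  | succ n ih =>
    rw [List.ofFn_succ, foldList]
    rcases Nat.mod_two_eq_zero_or_one k with h | h
    · obtain ⟨r, rfl⟩ : 2 ∣ k := Nat.dvd_of_mod_eq_zero h
      rw [pow_succ', Nat.mul_dvd_mul_iff_left two_pos] at hk
      rw [PF_two_mul f (by rintro rfl; simp at hk), ih _ hk, if_neg (by omega),
        if_neg (by omega), Nat.mul_div_cancel_left _ two_pos]
      rfl
    · rw [PF_of_odd f h]
      split_ifs with h1 h3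
      · rfl
      · rfl
      · omega

theorem PF_eq_one_or_neg_one {f : ℕ → ℤ} (hf : FoldingSeq f) (k : ℕ) :
    PF f k = 1 ∨ PF f k = -1 := by
  unfold PF
  rcases hf (padicValNat 2 k) with h | h <;> split_ifs <;> simp [h]

/-- Each choice of the first five instructions makes all eight sign words of length three occur,
and the position `m` of the last first occurrence lies in `{14, 16, 22, 24}`. -/
theorem foldList_words_of_length_three :
    ∀ a ∈ [1, -1], ∀ b ∈ [1, -1], ∀ c ∈ [1, -1], ∀ d ∈ [1, -1], ∀ e ∈ [1, -1],
      ∃ m ∈ [14, 16, 22, 24],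
        (∀ x ∈ [1, -1], ∀ y ∈ [1, -1], ∀ z ∈ [1, -1], ∃ j < m,
          foldList [a, b, c, d, e] (j + 1) = x ∧ foldList [a, b, c, d, e] (j + 2) = y ∧
            foldList [a, b, c, d, e] (j + 3) = z) ∧
        ∀ j < m - 1, ¬ (foldList [a, b, c, d, e] m = foldList [a, b, c, d, e] (j + 1) ∧
          foldList [a, b, c, d, e] (m + 1) = foldList [a, b, c, d, e] (j + 2) ∧
          foldList [a, b, c, d, e] (m + 2) = foldList [a, b, c, d, e] (j + 3)) := by
  decide +kernel

theorem factorMatch_three_iff (f : ℕ → ℤ) (i j : ℕ) :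
    FactorMatch f 3 i j ↔
      PF f i = PF f j ∧ PF f (i + 1) = PF f (j + 1) ∧ PF f (i + 2) = PF f (j + 2) := by
  constructor
  · intro h
    exact ⟨h 0 (by omega), h 1 (by omega), h 2 (by omega)⟩
  · rintro ⟨h0, h1, h2⟩ t ht
    interval_cases t
    exacts [h0, h1, h2]

theorem exists_last_first_occurrence {f : ℕ → ℤ} (hf : FoldingSeq f) :
    ∃ m ∈ [14, 16, 22, 24],
      (∀ i, ∃ j, 1 ≤ j ∧ j ≤ m ∧ FactorMatch f 3 i j) ∧
      ∀ j, 1 ≤ j → FactorMatch f 3 m j → m ≤ j := by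
  have mem (s : ℕ) : f s ∈ [1, -1] := by simpa using hf s
  have memP (k : ℕ) : PF f k ∈ [1, -1] := by simpa using PF_eq_one_or_neg_one hf k
  have hP {k : ℕ} (h0 : k ≠ 0) (h : k < 32) :
      PF f k = foldList [f 0, f 1, f 2, f 3, f 4] k :=
    PF_eq_foldList 5 f (Nat.not_dvd_of_pos_of_lt (by omega) h)
  obtain ⟨m, hm, hall, hnew⟩ := foldList_words_of_length_three _ (mem 0) _ (mem 1) _ (mem 2)
    _ (mem 3) _ (mem 4)
  have hm' : 1 ≤ m ∧ m ≤ 24 := by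
    simp only [List.mem_cons, List.not_mem_nil, or_false] at hm
    omega
  refine ⟨m, hm, fun i => ?_, fun j hj hmatch => ?_⟩
  · obtain ⟨j, hj, hx, hy, hz⟩ := hall _ (memP i) _ (memP (i + 1)) _ (memP (i + 2))
    refine ⟨j + 1, by omega, by omega, (factorMatch_three_iff f _ _).2 ?_⟩
    rw [hP (k := j + 1) (by omega) (by omega), hP (k := j + 1 + 1) (by omega) (by omega),
      hP (k := j + 1 + 2) (by omega) (by omega)]
    exact ⟨hx.symm, hy.symm, hz.symm⟩
  · by_contra! hlt
    obtain ⟨j, rfl⟩ := Nat.exists_eq_add_of_le' hj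
    rw [factorMatch_three_iff, hP (k := m) (by omega) (by omega),
      hP (k := m + 1) (by omega) (by omega), hP (k := m + 2) (by omega) (by omega),
      hP (k := j + 1) (by omega) (by omega), hP (k := j + 1 + 1) (by omega) (by omega),
      hP (k := j + 1 + 2) (by omega) (by omega)] at hmatch
    exact hnew j (by omega) hmatch

theorem stmt10 (f : ℕ → ℤ) (hf : FoldingSeq f) :
    Sf f 3 ∈ ({14, 16, 22, 24} : Set ℕ) ∧ Af f 3 ∈ ({16, 18, 24, 26} : Set ℕ) := by
  obtain ⟨m, hm, hall, hnew⟩ := exists_last_first_occurrence hf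
  simp only [List.mem_cons, List.not_mem_nil, or_false] at hm
  have hS : Sf f 3 = m := by
    refine IsLeast.csInf_eq ⟨⟨by omega, fun i _ => hall i⟩, ?_⟩
    rintro m' ⟨-, h⟩
    obtain ⟨j, hj, hjm, hmatch⟩ := h m (by omega)
    exact (hnew j hj hmatch).trans hjm
  have hA : Af f 3 = m + 2 := by
    refine IsLeast.csInf_eq ⟨⟨by omega, fun i _ => ?_⟩, ?_⟩
    · obtain ⟨j, hj, hjm, hmatch⟩ := hall i
      exact ⟨j, hj, by omega, hmatch⟩
    · rintro m' ⟨-, h⟩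
      obtain ⟨j, hj, hjm, hmatch⟩ := h m (by omega)
      have := hnew j hj hmatch
      omega
  rw [hS, hA]
  simp only [Set.mem_insert_iff, Set.mem_singleton_iff]
  omega
end
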